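/- arXiv:1905.04324 — 2 statements merged into one kernel-verified Lean document; each statement's English description precedes it below -/
import Mathlib

section
/- Fix an integer M ≥ 2. There is a constant C = C(M) > 0 such that for every nonnegative function f on ℤ and every vector v ∈ ℝ^M all of whose components are 1 or −1, ∑_{k ∈ ℤ^M} f(k·v) ∏_{j=1}^M f(k_j) ≤ C (∑_{k∈ℤ} f(k)^{1+1/M})^M, where k = (k_1,…,k_M) and k·v = ∑_j k_j v_j. -/
open scoped ENNReal BigOperators

/-- The sum over `Fin n → α` of a product of one-variable factors is a power of a single sum. -/
theorem ENNReal.tsum_pi_prod_eq_pow {α : Type*} (g : α → ℝ≥0∞) (n : ℕ) :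
    ∑' k : Fin n → α, ∏ j, g (k j) = (∑' a, g a) ^ n := by
  induction n with
  | zero => simp [tsum_fintype]
  | succ n ih =>
    rw [← (Fin.consEquiv fun _ : Fin (n + 1) => α).tsum_eq, ENNReal.tsum_prod']
    simp only [Fin.consEquiv_apply, Fin.prod_univ_succ, Fin.cons_zero, Fin.cons_succ,
      ENNReal.tsum_mul_left, ih, ENNReal.tsum_mul_right]
    rw [pow_succ']

/-- Hölder's inequality for countable sums of finite products, with constant exponent. -/
theorem ENNReal.tsum_prod_rpow_le {κ ι : Type*} [Fintype ι] [Nonempty ι]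
    (F : ι → κ → ℝ≥0∞) :
    ∑' k, ∏ i, F i k ^ (1 / (Fintype.card ι : ℝ)) ≤
      ∏ i, (∑' k, F i k) ^ (1 / (Fintype.card ι : ℝ)) := by
  let _ : MeasurableSpace κ := ⊤
  have : DiscreteMeasurableSpace κ := ⟨fun _ => trivial⟩
  have h := ENNReal.lintegral_prod_norm_pow_le (μ := MeasureTheory.Measure.count)
    Finset.univ (f := F) (fun i _ => Measurable.of_discrete.aemeasurable)
    (p := fun _ => 1 / (Fintype.card ι : ℝ)) (by simp) (fun _ _ => by positivity)
  simpa only [MeasureTheory.lintegral_count] using h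

/-- Replacing one coordinate of `k` by a linear form whose coefficient there is nonzero is
injective. -/
theorem injective_update_linear_form {ι : Type*} [Fintype ι] [DecidableEq ι] (v : ι → ℤ) (i : ι)
    (hv : v i ≠ 0) :
    Function.Injective fun k : ι → ℤ => Function.update k i (∑ j, k j * v j) := by
  intro k l h
  have hoff : ∀ j, j ≠ i → k j = l j := fun j hj => by
    simpa [Function.update_of_ne hj] using congrFun h j
  have hsum : ∑ j, k j * v j = ∑ j, l j * v j := by simpa using congrFun h i
  rw [← Finset.add_sum_erase _ _ (Finset.mem_univ i),
    ← Finset.add_sum_erase _ (fun j => l j * v j) (Finset.mem_univ i),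
    Finset.sum_congr rfl fun j hj => by rw [hoff j (Finset.ne_of_mem_erase hj)]] at hsum
  funext j
  by_cases hj : j = i
  · subst hj
    exact mul_right_cancel₀ hv (add_right_cancel hsum)
  · exact hoff j hj

theorem prod_mul_prod_prod_update {ι α N : Type*} [Fintype ι] [DecidableEq ι] [CommMonoid N]
    (g : α → N) (k : ι → α) (a : α) :
    (∏ j, g (k j)) * ∏ i, ∏ j, g (Function.update k i a j) =
      (g a * ∏ j, g (k j)) ^ Fintype.card ι := by
  rw [← Finset.prod_mul_distrib, ← Finset.card_univ, ← Finset.prod_const]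
  refine Finset.prod_congr rfl fun i _ => ?_
  rw [← Finset.mul_prod_erase _ _ (Finset.mem_univ i),
    ← Finset.mul_prod_erase _ (fun j => g (k j)) (Finset.mem_univ i), Function.update_self,
    Finset.prod_congr rfl fun j hj => by rw [Function.update_of_ne (Finset.ne_of_mem_erase hj)]]
  exact mul_left_comm _ _ _

theorem ENNReal.tsum_linear_form_mul_prod_le {M : ℕ} (hM : M ≠ 0) (h : ℤ → ℝ≥0∞)
    (v : Fin M → ℤ) (hv : ∀ j, v j ≠ 0) :
    ∑' k : Fin M → ℤ, h (∑ j, k j * v j) * ∏ j, h (k j) ≤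
      (∑' k, h k ^ ((1 : ℝ) + 1 / M)) ^ M := by
  set g : ℤ → ℝ≥0∞ := fun x => h x ^ ((1 : ℝ) + 1 / M)
  let F : Option (Fin M) → (Fin M → ℤ) → ℝ≥0∞ := fun o k =>
    o.elim (∏ j, g (k j)) fun i => ∏ j, g (Function.update k i (∑ l, k l * v l) j)
  have hM' : (M : ℝ) ≠ 0 := Nat.cast_ne_zero.mpr hM
  have hM1 : (M : ℝ) + 1 ≠ 0 := by positivity
  have hF : ∀ o, ∑' k, F o k ≤ (∑' x, g x) ^ M := by
    rintro (_ | i)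
    · exact (ENNReal.tsum_pi_prod_eq_pow g M).le
    · rw [← ENNReal.tsum_pi_prod_eq_pow g M]
      exact ENNReal.tsum_comp_le_tsum_of_injective (injective_update_linear_form v i (hv i))
        fun k => ∏ j, g (k j)
  have hprod : ∀ k : Fin M → ℤ, h (∑ j, k j * v j) * ∏ j, h (k j) =
      ∏ o, F o k ^ (1 / (Fintype.card (Option (Fin M)) : ℝ)) := fun k => by
    rw [ENNReal.prod_rpow_of_nonneg (by positivity), Fintype.prod_option]
    simp only [F, Option.elim]
    rw [prod_mul_prod_prod_update, ENNReal.prod_rpow_of_nonneg (by positivity),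
      ← ENNReal.mul_rpow_of_nonneg _ _ (by positivity), ← ENNReal.rpow_natCast,
      ← ENNReal.rpow_mul, ← ENNReal.rpow_mul]
    simp only [Fintype.card_option, Fintype.card_fin, Nat.cast_add, Nat.cast_one]
    rw [show ((1 : ℝ) + 1 / M) * (M * (1 / (M + 1))) = 1 by field_simp, ENNReal.rpow_one]
  calc ∑' k : Fin M → ℤ, h (∑ j, k j * v j) * ∏ j, h (k j)
      = ∑' k, ∏ o, F o k ^ (1 / (Fintype.card (Option (Fin M)) : ℝ)) := tsum_congr hprod
    _ ≤ ∏ o, (∑' k, F o k) ^ (1 / (Fintype.card (Option (Fin M)) : ℝ)) :=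
      ENNReal.tsum_prod_rpow_le F
    _ ≤ ∏ _o : Option (Fin M),
        ((∑' x, g x) ^ M) ^ (1 / (Fintype.card (Option (Fin M)) : ℝ)) := by
      gcongr with o
      exact hF o
    _ = (∑' x, g x) ^ M := by
      rw [Finset.prod_const, Finset.card_univ, ← ENNReal.rpow_natCast, ← ENNReal.rpow_mul,
        one_div_mul_cancel (by simp; positivity), ENNReal.rpow_one]

/-- Young-type convolution bound (Lemma 2.4(i)): for a nonnegative f on ℤ and a vector v
with entries ±1, ∑_{k ∈ ℤ^M} f(k·v) ∏_j f(k_j) ≤ C (∑_k f(k)^{1+1/M})^M. -/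
theorem sum_shift_bound_pm_one (M : ℕ) (hM : 2 ≤ M) :
    ∃ C : ℝ, 0 < C ∧ ∀ f : ℤ → ℝ, (∀ k, 0 ≤ f k) →
      ∀ v : Fin M → ℤ, (∀ j, v j = 1 ∨ v j = -1) →
        (∑' k : Fin M → ℤ,
            ENNReal.ofReal (f (∑ j, k j * v j)) * ∏ j, ENNReal.ofReal (f (k j))) ≤
          ENNReal.ofReal C *
            (∑' k : ℤ, ENNReal.ofReal (f k ^ ((1 : ℝ) + 1 / M))) ^ M := by
  refine ⟨1, one_pos, fun f hf v hv => ?_⟩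
  have h := ENNReal.tsum_linear_form_mul_prod_le (M := M) (by omega) (fun x => ENNReal.ofReal (f x)) v
    fun j => by rcases hv j with h | h <;> simp [h]
  simpa only [ENNReal.ofReal_one, one_mul,
    ENNReal.ofReal_rpow_of_nonneg (hf _) (show (0 : ℝ) ≤ 1 + 1 / M by positivity)] using h
end

section
/- Let (X_1,…,X_M) be a centered jointly Gaussian random vector with E[X_j²] = 1 for all j and covariances ρ_{jk} = E[X_j X_k] for 1 ≤ j < k ≤ M, and let q_1,…,q_M ≥ 1 be integers. Then E[∏_{i=1}^M H_{q_i}(X_i)] = ∑_{β ∈ D_q} ( ∏_{i=1}^M q_i! / ∏_{1≤j<k≤M} β_{jk}! ) ∏_{1≤j<k≤M} ρ_{jk}^{β_{jk}}, where D_q is the set of families of nonnegative integers (β_{jk})_{1≤j<k≤M} satisfying q_i = ∑_{j or k = i} β_{jk} for each i = 1,…,M. -/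
open MeasureTheory ProbabilityTheory
open scoped ENNReal NNReal BigOperators

noncomputable section

/-- Probabilists' Hermite polynomial as a real function. -/
def Hpoly (q : ℕ) (x : ℝ) : ℝ := Polynomial.aeval x (Polynomial.hermite q)

/-- `f` has finite moments of every order with respect to `μ`. -/
def HasAllMoments {Ω : Type*} [MeasurableSpace Ω] (f : Ω → ℝ) (μ : Measure Ω) : Prop :=
  ∀ p : ℝ≥0, MemLp f p μ

namespace HasAllMoments

variable {Ω : Type*} [MeasurableSpace Ω] {μ : Measure Ω} {f g : Ω → ℝ}

theorem integrable (hf : HasAllMoments f μ) : Integrable f μ :=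
  memLp_one_iff_integrable.1 (by simpa using hf 1)

theorem add (hf : HasAllMoments f μ) (hg : HasAllMoments g μ) :
    HasAllMoments (fun ω => f ω + g ω) μ :=
  fun p => (hf p).add (hg p)

theorem mul (hf : HasAllMoments f μ) (hg : HasAllMoments g μ) :
    HasAllMoments (fun ω => f ω * g ω) μ := fun p => by
  have : ENNReal.HolderTriple ((2 * p : ℝ≥0) : ℝ≥0∞) ((2 * p : ℝ≥0) : ℝ≥0∞) p := ⟨by
    rw [ENNReal.coe_mul, ENNReal.mul_inv (by simp) (by simp), ← add_mul]
    simp [ENNReal.inv_two_add_inv_two]⟩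
  exact (hg (2 * p)).mul' (hf (2 * p))

theorem const [IsFiniteMeasure μ] (c : ℝ) : HasAllMoments (fun _ : Ω => c) μ :=
  fun _ => memLp_const c

theorem prod [IsFiniteMeasure μ] {ι : Type*} (s : Finset ι) {F : ι → Ω → ℝ}
    (hF : ∀ i, HasAllMoments (F i) μ) : HasAllMoments (fun ω => ∏ i ∈ s, F i ω) μ := by
  classical
  induction s using Finset.induction_on with
  | empty => simpa using const 1
  | insert i s his ih => simpa [Finset.prod_insert his] using (hF i).mul ih

theorem eval [IsFiniteMeasure μ] (hf : HasAllMoments f μ) (p : Polynomial ℝ) :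
    HasAllMoments (fun ω => p.eval (f ω)) μ := by
  induction p using Polynomial.induction_on' with
  | add p r hp hr => simpa using hp.add hr
  | monomial n a =>
    simpa using (const a).mul (prod (Finset.range n) fun _ => hf)

end HasAllMoments

theorem hasAllMoments_id_gaussianReal (m : ℝ) (v : ℝ≥0) :
    HasAllMoments (fun x => x) (gaussianReal m v) :=
  fun p => memLp_id_gaussianReal p

theorem ProbabilityTheory.HasGaussianLaw.hasAllMoments {Ω : Type*} [MeasurableSpace Ω]
    {P : Measure Ω} {f : Ω → ℝ} (hf : HasGaussianLaw f P) : HasAllMoments f P :=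
  fun _ => hf.memLp ENNReal.coe_ne_top

theorem hasDerivAt_gaussianPDFReal_zero_one (x : ℝ) :
    HasDerivAt (gaussianPDFReal 0 1) (-(x * gaussianPDFReal 0 1 x)) x := by
  have h : HasDerivAt (fun y : ℝ => -(y - 0) ^ 2 / (2 * ((1 : ℝ≥0) : ℝ))) (-x) x := by
    have := (((hasDerivAt_id x).sub_const 0).pow 2).neg.div_const (2 * ((1 : ℝ≥0) : ℝ))
    convert! this using 1
    simp
    ring
  convert! h.exp.const_mul (√(2 * Real.pi * ((1 : ℝ≥0) : ℝ)))⁻¹ using 1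
  simp only [gaussianPDFReal]
  ring

theorem integrable_eval_mul_gaussianPDFReal (p : Polynomial ℝ) :
    Integrable fun x => p.eval x * gaussianPDFReal 0 1 x := by
  have h := ((hasAllMoments_id_gaussianReal 0 1).eval p).integrable
  rw [gaussianReal_of_var_ne_zero 0 one_ne_zero,
    integrable_withDensity_iff_integrable_smul' (measurable_gaussianPDF 0 1)
      (by simp [gaussianPDF])] at h
  simpa [gaussianPDF, ENNReal.toReal_ofReal (gaussianPDFReal_nonneg 0 1 _), mul_comm] using h

/-- Stein's identity for polynomials. -/
theorem integral_mul_eval_gaussianReal (p : Polynomial ℝ) :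
    ∫ x, x * p.eval x ∂gaussianReal 0 1 = ∫ x, p.derivative.eval x ∂gaussianReal 0 1 := by
  rw [integral_gaussianReal_eq_integral_smul one_ne_zero,
    integral_gaussianReal_eq_integral_smul one_ne_zero]
  have h := integral_mul_deriv_eq_deriv_mul_of_integrable (u := fun x => p.eval x)
    (fun x _ => p.hasDerivAt x) (fun x _ => hasDerivAt_gaussianPDFReal_zero_one x)
    (by
      convert! (integrable_eval_mul_gaussianPDFReal (Polynomial.X * p)).neg using 1
      ext x
      simp
      ring)
    (integrable_eval_mul_gaussianPDFReal _) (integrable_eval_mul_gaussianPDFReal _)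
  rw [← neg_inj, ← integral_neg]
  convert! h using 2
  · ext x
    simp
    ring
  · simp [mul_comm]

section GaussianVector

variable {Ω : Type*} [MeasurableSpace Ω] {P : Measure Ω} {ι : Type*} [Fintype ι]
  {X : ι → Ω → ℝ}

theorem hasGaussianLaw_of_map_sum_eq_gaussianReal (hmeas : ∀ i, Measurable (X i))
    (hgauss : ∀ a : ι → ℝ, ∃ v : ℝ≥0,
      Measure.map (fun ω => ∑ i, a i * X i ω) P = gaussianReal 0 v) :
    HasGaussianLaw (fun ω i => X i ω) P where
  isGaussian_map := by
    classical
    refine isGaussian_of_map_eq_gaussianReal fun L => ?_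
    obtain ⟨v, hv⟩ := hgauss fun i => L (Pi.single i 1)
    refine ⟨0, v, ?_⟩
    rw [Measure.map_map (by fun_prop) (by fun_prop), ← hv]
    congr 1
    ext ω
    have := L.toLinearMap.pi_apply_eq_sum_univ (fun i => X i ω)
    simp only [ContinuousLinearMap.coe_coe, smul_eq_mul] at this
    simp only [Function.comp_apply, this]
    refine Finset.sum_congr rfl fun i _ => ?_
    rw [mul_comm]
    congr 2
    ext k
    simp [Pi.single_apply, eq_comm]

theorem HasGaussianLaw.indepFun_regression_residual (hX : HasGaussianLaw (fun ω i => X i ω) P)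
    (hcentered : ∀ i, ∫ ω, X i ω ∂P = 0) (j : ι) (hvar : ∫ ω, X j ω ^ 2 ∂P = 1) :
    IndepFun (X j) (fun ω k => X k ω - (∫ η, X j η * X k η ∂P) * X j ω) P := by
  have := hX.isProbabilityMeasure
  set c : ι → ℝ := fun k => ∫ η, X j η * X k η ∂P with hc
  have hmom (i : ι) : HasAllMoments (X i) P := (hX.eval i).hasAllMoments
  have hmem {f : Ω → ℝ} (hf : HasAllMoments f P) : MemLp f 2 P := by simpa using hf 2
  have hlaw : HasGaussianLaw
      (fun ω => ((fun _ : Unit => X j ω), fun k => X k ω - c k * X j ω)) P := by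
    have := hX.map_fun ((ContinuousLinearMap.pi fun _ : Unit =>
      (ContinuousLinearMap.proj j : (ι → ℝ) →L[ℝ] ℝ)).prod
        (ContinuousLinearMap.pi fun k => ContinuousLinearMap.proj k -
          c k • (ContinuousLinearMap.proj j : (ι → ℝ) →L[ℝ] ℝ)))
    exact this
  refine (hlaw.indepFun_of_covariance_eval (X := fun _ => X j)
    (Y := fun k ω => X k ω - c k * X j ω) fun _ k => ?_).comp (measurable_pi_apply ())
      measurable_id
  have hres : HasAllMoments (fun ω => X k ω + -c k * X j ω) P :=
    (hmom k).add ((HasAllMoments.const (-c k)).mul (hmom j))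
  have hres' : HasAllMoments (fun ω => X k ω - c k * X j ω) P := by
    simpa [sub_eq_add_neg] using hres
  rw [covariance_eq_sub (hmem (hmom j)) (hmem hres'), hcentered j, zero_mul, sub_zero]
  have h1 : ∀ ω, (X j * fun ω => X k ω - c k * X j ω) ω =
      X j ω * X k ω - c k * X j ω ^ 2 := fun ω => by simp; ring
  simp_rw [h1]
  rw [integral_sub ((hmom j).mul (hmom k)).integrable
    (by simpa [pow_two] using ((hmom j).mul (hmom j)).integrable.const_mul (c k)),
    integral_const_mul, hvar]
  simp [hc]

/-- Gaussian integration by parts for products of polynomials in the coordinates. -/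
theorem HasGaussianLaw.integral_mul_prod_eval [DecidableEq ι]
    (hX : HasGaussianLaw (fun ω i => X i ω) P)
    (hmeas : ∀ i, Measurable (X i))
    (hcentered : ∀ i, ∫ ω, X i ω ∂P = 0) (j : ι) (hvar : ∫ ω, X j ω ^ 2 ∂P = 1)
    (p : ι → Polynomial ℝ) :
    ∫ ω, X j ω * ∏ i, (p i).eval (X i ω) ∂P =
      ∑ k, (∫ ω, X j ω * X k ω ∂P) *
        ∫ ω, (∏ i ∈ Finset.univ.erase k, (p i).eval (X i ω)) *
          (p k).derivative.eval (X k ω) ∂P := by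
  have := hX.isProbabilityMeasure
  have hind := HasGaussianLaw.indepFun_regression_residual hX hcentered j hvar
  set c : ι → ℝ := fun k => ∫ η, X j η * X k η ∂P with hc
  have hmom (i : ι) : HasAllMoments (X i) P := (hX.eval i).hasAllMoments
  set Y : Ω → ι → ℝ := fun ω k => X k ω - c k * X j ω with hY
  have hYm : Measurable Y := by fun_prop
  have hprod (ω : Ω) (i : ι) : c i * X j ω + Y ω i = X i ω := by simp [hY]
  have hint1 : HasAllMoments (fun ω => X j ω * ∏ i, (p i).eval (X i ω)) P :=
    (hmom j).mul (.prod _ fun i => (hmom i).eval (p i))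
  have hint2 (k : ι) : HasAllMoments
      (fun ω => (∏ i ∈ Finset.univ.erase k, (p i).eval (X i ω)) *
        (p k).derivative.eval (X k ω)) P :=
    .mul (.prod _ fun i => (hmom i).eval (p i)) ((hmom k).eval _)
  have hlaw : P.map (X j) = gaussianReal 0 1 := by
    have h := (hX.eval j).map_eq_gaussianReal
    have hv : Var[X j; P] = 1 := by
      rw [variance_of_integral_eq_zero (hmeas j).aemeasurable (hcentered j)]
      exact hvar
    rw [h, hcentered j, hv, Real.toNNReal_one]
  have hmap := (indepFun_iff_map_prod_eq_prod_map_map (hmeas j).aemeasurable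
    hYm.aemeasurable).1 hind
  rw [hlaw] at hmap
  have hPY : IsProbabilityMeasure (P.map Y) := Measure.isProbabilityMeasure_map hYm.aemeasurable
  have hpair : Measurable fun ω => (X j ω, Y ω) := (hmeas j).prodMk hYm
  have fubini (F : ℝ × (ι → ℝ) → ℝ) (hF : Measurable F)
      (hFi : Integrable (fun ω => F (X j ω, Y ω)) P) :
      ∫ ω, F (X j ω, Y ω) ∂P = ∫ y, ∫ x, F (x, y) ∂gaussianReal 0 1 ∂P.map Y := by
    rw [← integral_prod_symm, ← hmap, integral_map hpair.aemeasurable hF.aestronglyMeasurable]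
    rw [← hmap]
    exact (integrable_map_measure hF.aestronglyMeasurable hpair.aemeasurable).2 hFi
  have hev (r : Polynomial ℝ) (i : ι) :
      Measurable fun z : ℝ × (ι → ℝ) => r.eval (c i * z.1 + z.2 i) :=
    r.continuous.measurable.comp (by fun_prop)
  have e1 := fubini (fun z => z.1 * ∏ i, (p i).eval (c i * z.1 + z.2 i))
    (measurable_fst.mul (Finset.measurable_fun_prod Finset.univ fun i _ => hev (p i) i))
    (by simpa only [hprod] using hint1.integrable)
  have e2 := fubini (fun z => ∑ k, c k *
      ((∏ i ∈ Finset.univ.erase k, (p i).eval (c i * z.1 + z.2 i)) *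
        (p k).derivative.eval (c k * z.1 + z.2 k)))
    (Finset.measurable_fun_sum Finset.univ fun k _ => measurable_const.mul
      ((Finset.measurable_fun_prod (Finset.univ.erase k) fun i _ => hev (p i) i).mul (hev _ k)))
    (by
      simpa only [hprod] using integrable_finsetSum Finset.univ
        fun k _ => (hint2 k).integrable.const_mul (c k))
  simp only [hprod] at e1 e2
  rw [integral_finsetSum _ fun k _ => (hint2 k).integrable.const_mul (c k)] at e2
  simp only [integral_const_mul] at e2
  rw [e1, e2]
  congr 1 with y
  have h := integral_mul_eval_gaussianReal
    (∏ i, (p i).comp (Polynomial.C (c i) * Polynomial.X + Polynomial.C (y i)))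
  rw [Polynomial.derivative_prod_finset] at h
  simp only [Polynomial.eval_prod, Polynomial.eval_finsetSum] at h
  convert! h using 3 <;> simp [Polynomial.eval_prod, Polynomial.derivative_comp]
  exact Finset.sum_congr rfl fun k _ => by ring

end GaussianVector

section Multigraph

variable {ι E : Type*} [Fintype E] {v : E → ι → ℕ}

theorem finite_setOf_sum_mul_eq (hv : ∀ e, v e ≠ 0) (q : ι → ℕ) :
    {β : E → ℕ | ∀ i, ∑ e, β e * v e i = q i}.Finite := by
  choose i hi using fun e => Function.ne_iff.1 (hv e)
  refine (Set.Finite.pi fun e => Set.finite_Iic (q (i e))).subset fun β hβ e _ => ?_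
  calc β e ≤ β e * v e (i e) := Nat.le_mul_of_pos_right _ (Nat.pos_of_ne_zero (hi e))
    _ ≤ ∑ e', β e' * v e' (i e) :=
      Finset.single_le_sum (f := fun e' => β e' * v e' (i e)) (fun _ _ => Nat.zero_le _)
        (Finset.mem_univ e)
    _ = q (i e) := hβ _

/-- Edge multiplicities `β` realizing the degrees `q`, where `v e i` is the incidence number of the
edge `e` at the vertex `i`. -/
def multiplicities (hv : ∀ e, v e ≠ 0) (q : ι → ℕ) : Finset (E → ℕ) :=
  (finite_setOf_sum_mul_eq hv q).toFinset

theorem mem_multiplicities {hv : ∀ e, v e ≠ 0} {q : ι → ℕ} {β : E → ℕ} :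
    β ∈ multiplicities hv q ↔ ∀ i, ∑ e, β e * v e i = q i := by
  simp [multiplicities]

/-- The coefficient of `t ^ q` in `∏ e, exp (r e * t ^ v e)`. -/
def diagramSum (hv : ∀ e, v e ≠ 0) (r : E → ℝ) (q : ι → ℕ) : ℝ :=
  ∑ β ∈ multiplicities hv q, ∏ e, r e ^ β e / (β e).factorial

theorem diagramSum_zero (hv : ∀ e, v e ≠ 0) (r : E → ℝ) : diagramSum hv r 0 = 1 := by
  have h : multiplicities hv 0 = {0} := by
    ext β
    rw [mem_multiplicities, Finset.mem_singleton]
    refine ⟨fun h => funext fun e => ?_, fun h => by simp [h]⟩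
    obtain ⟨i, hi⟩ := Function.ne_iff.1 (hv e)
    have := (Finset.sum_eq_zero_iff.1 (h i)) e (Finset.mem_univ e)
    exact (mul_eq_zero.1 this).resolve_right hi
  simp [diagramSum, h]

variable [DecidableEq E]

theorem sum_add_single_mul (β : E → ℕ) (e : E) (i : ι) :
    ∑ e', (β + Pi.single e 1 : E → ℕ) e' * v e' i = ∑ e', β e' * v e' i + v e i := by
  simp [add_mul, Finset.sum_add_distrib, Pi.single_apply]

theorem add_one_mul_prod_add_single (r : E → ℝ) (β : E → ℕ) (e : E) :
    ((β + Pi.single e 1 : E → ℕ) e : ℝ) * ∏ e', r e' ^ (β + Pi.single e 1 : E → ℕ) e' /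
      ((β + Pi.single e 1 : E → ℕ) e').factorial =
    r e * ∏ e', r e' ^ β e' / (β e').factorial := by
  rw [← Finset.mul_prod_erase _ _ (Finset.mem_univ e),
    ← Finset.mul_prod_erase (a := e) (f := fun e' => r e' ^ β e' / ((β e').factorial : ℝ))
      _ (Finset.mem_univ e)]
  have h : ∀ e' ∈ Finset.univ.erase e, r e' ^ (β + Pi.single e 1 : E → ℕ) e' /
      (((β + Pi.single e 1 : E → ℕ) e').factorial : ℝ) = r e' ^ β e' / (β e').factorial := by
    intro e' he'
    simp [Finset.ne_of_mem_erase he']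
  rw [Finset.prod_congr rfl h]
  simp only [Pi.add_apply, Pi.single_eq_same, Nat.factorial_succ, pow_succ]
  have h1 : ((β e).factorial : ℝ) ≠ 0 := by positivity
  have h2 : ((β e : ℝ) + 1) ≠ 0 := by positivity
  push_cast
  field_simp

theorem sum_multiplicity_mul_prod [DecidableLE (ι → ℕ)] (hv : ∀ e, v e ≠ 0) (r : E → ℝ)
    (q : ι → ℕ) (e : E) :
    ∑ β ∈ multiplicities hv q, (β e : ℝ) * ∏ e', r e' ^ β e' / (β e').factorial =
      r e * if v e ≤ q then diagramSum hv r (q - v e) else 0 := by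
  split_ifs with hq
  · rw [diagramSum, Finset.mul_sum]
    symm
    have hmem (β : E → ℕ) : β ∈ multiplicities hv (q - v e) ↔
        β + Pi.single e 1 ∈ multiplicities hv q := by
      simp only [mem_multiplicities, sum_add_single_mul, Pi.sub_apply]
      exact forall_congr' fun i => by have : v e i ≤ q i := hq i; omega
    refine Finset.sum_bij_ne_zero (fun β _ _ => β + Pi.single e 1)
      (fun β hβ _ => (hmem β).1 hβ) (fun _ _ _ _ _ _ h => add_right_cancel h)
      (fun β hβ hne => ?_) fun β _ _ => (add_one_mul_prod_add_single r β e).symm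
    have hpos : 1 ≤ β e := by
      by_contra! h
      simp [Nat.lt_one_iff.1 h] at hne
    have hβe : β - Pi.single e 1 + Pi.single e 1 = β :=
      tsub_add_cancel_of_le (by
        intro e'
        rcases eq_or_ne e' e with rfl | h
        · simpa using hpos
        · simp [h])
    refine ⟨β - Pi.single e 1, (hmem _).2 (hβe.symm ▸ hβ), ?_, hβe⟩
    rw [← add_one_mul_prod_add_single, hβe]
    exact hne
  · rw [mul_zero]
    refine Finset.sum_eq_zero fun β hβ => ?_
    suffices β e = 0 by simp [this]
    by_contra h
    refine hq fun i => ?_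
    rw [← mem_multiplicities.1 hβ i]
    calc v e i ≤ β e * v e i := Nat.le_mul_of_pos_left _ (Nat.pos_of_ne_zero h)
      _ ≤ _ := Finset.single_le_sum (f := fun e' => β e' * v e' i) (fun _ _ => Nat.zero_le _)
        (Finset.mem_univ e)

theorem degree_mul_diagramSum [DecidableLE (ι → ℕ)] (hv : ∀ e, v e ≠ 0) (r : E → ℝ)
    (q : ι → ℕ) (j : ι) :
    q j * diagramSum hv r q =
      ∑ e, v e j * (r e * if v e ≤ q then diagramSum hv r (q - v e) else 0) := by
  simp_rw [← sum_multiplicity_mul_prod hv r q, Finset.mul_sum]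
  rw [Finset.sum_comm, diagramSum, Finset.mul_sum]
  refine Finset.sum_congr rfl fun β hβ => ?_
  rw [← mem_multiplicities.1 hβ j]
  push_cast
  rw [Finset.sum_mul]
  exact Finset.sum_congr rfl fun e _ => by ring

end Multigraph

/-- The indicator of the two endpoints of an edge of the complete graph. -/
def endpoints {ι : Type*} [LinearOrder ι] (e : {e : ι × ι // e.1 < e.2}) : ι → ℕ :=
  Pi.single e.1.1 1 + Pi.single e.1.2 1

theorem endpoints_ne_zero {ι : Type*} [LinearOrder ι] (e : {e : ι × ι // e.1 < e.2}) :
    endpoints e ≠ 0 :=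
  Function.ne_iff.2 ⟨e.1.1, by simp [endpoints]⟩

theorem sum_subtype_lt {ι α : Type*} [LinearOrder ι] [Fintype ι] [AddCommMonoid α]
    (f : ι → ι → α) :
    ∑ e : {e : ι × ι // e.1 < e.2}, f e.1.1 e.1.2 = ∑ j, ∑ k, if j < k then f j k else 0 := by
  rw [← Fintype.sum_prod_type' (fun j k => if j < k then f j k else 0), ← Finset.sum_filter]
  exact (Finset.sum_subtype _ (by simp) (fun e : ι × ι => f e.1 e.2)).symm

theorem prod_subtype_lt {ι α : Type*} [LinearOrder ι] [Fintype ι] [CommMonoid α]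
    (f : ι → ι → α) :
    ∏ e : {e : ι × ι // e.1 < e.2}, f e.1.1 e.1.2 = ∏ j, ∏ k, if j < k then f j k else 1 :=
  sum_subtype_lt (α := Additive α) f

theorem sum_endpoints_mul {ι : Type*} [LinearOrder ι] [Fintype ι] (S : ι → ι → ℝ)
    (hS : ∀ a b, S a b = S b a) (j : ι) :
    ∑ e : {e : ι × ι // e.1 < e.2}, (endpoints e j : ℝ) * S e.1.1 e.1.2 =
      ∑ k ∈ Finset.univ.erase j, S j k := by
  have h := sum_subtype_lt fun a b : ι =>
    (((Pi.single a 1 + Pi.single b 1 : ι → ℕ) j : ℕ) : ℝ) * S a b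
  refine h.trans ?_
  have h2 : ∀ a b : ι, (if a < b then
      (((Pi.single a 1 + Pi.single b 1 : ι → ℕ) j : ℕ) : ℝ) * S a b else 0) =
      (if a = j then if a < b then S a b else 0 else 0) +
        if b = j then if a < b then S a b else 0 else 0 := by
    intro a b
    simp only [Pi.add_apply, Pi.single_apply, eq_comm (a := j)]
    split_ifs <;> simp [two_mul]
  simp_rw [h2, Finset.sum_add_distrib]
  rw [Finset.sum_comm]
  simp only [Finset.sum_ite_eq', Finset.mem_univ, if_true]
  rw [← Finset.sum_add_distrib, ← Finset.sum_erase_add _ _ (Finset.mem_univ j)]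
  simp only [lt_irrefl, if_false, add_zero]
  refine Finset.sum_congr rfl fun k hk => ?_
  rcases lt_or_gt_of_ne (Finset.ne_of_mem_erase hk) with h | h
  · simp [h, h.not_gt, hS k j]
  · simp [h, h.not_gt]

section Hermite

open Polynomial

theorem Hpoly_eq_eval (n : ℕ) (x : ℝ) :
    Hpoly n x = ((hermite n).map (Int.castRingHom ℝ)).eval x := by
  rw [Hpoly, aeval_def, eval_map]
  rfl

theorem derivative_hermite_succ (n : ℕ) :
    derivative (hermite (n + 1)) = (n + 1 : ℤ[X]) * hermite n := by
  induction n with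
  | zero => simp
  | succ n ih =>
    rw [hermite_succ (n + 1), derivative_sub, derivative_mul, ih, hermite_succ n]
    simp only [derivative_mul, derivative_X, derivative_add, derivative_natCast, derivative_one]
    push_cast
    ring

theorem derivative_hermite (n : ℕ) :
    derivative (hermite n) = (n : ℤ[X]) * hermite (n - 1) := by
  cases n with
  | zero => simp
  | succ n => simpa using derivative_hermite_succ n

theorem eval_derivative_hermite (n : ℕ) (x : ℝ) :
    (derivative ((hermite n).map (Int.castRingHom ℝ))).eval x = n * Hpoly (n - 1) x := by
  rw [derivative_map, derivative_hermite, Hpoly_eq_eval]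
  simp

theorem Hpoly_succ (n : ℕ) (x : ℝ) :
    Hpoly (n + 1) x = x * Hpoly n x - n * Hpoly (n - 1) x := by
  rw [← eval_derivative_hermite, Hpoly_eq_eval, Hpoly_eq_eval, hermite_succ]
  simp

end Hermite

theorem prod_factorial_add_single {ι : Type*} [Fintype ι] [DecidableEq ι] (q : ι → ℕ) (j : ι) :
    ∏ i, (((q + Pi.single j 1 : ι → ℕ) i).factorial : ℝ) =
      (∏ i, ((q i).factorial : ℝ)) * ((q + Pi.single j 1 : ι → ℕ) j : ℝ) := by
  rw [← Finset.prod_erase_mul (a := j) _ _ (Finset.mem_univ j),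
    ← Finset.prod_erase_mul (a := j) (f := fun i => ((q i).factorial : ℝ)) _
      (Finset.mem_univ j)]
  have : ∏ i ∈ Finset.univ.erase j, (((q + Pi.single j 1 : ι → ℕ) i).factorial : ℝ) =
      ∏ i ∈ Finset.univ.erase j, ((q i).factorial : ℝ) :=
    Finset.prod_congr rfl fun i hi => by simp [Finset.ne_of_mem_erase hi]
  rw [this, Pi.add_apply, Pi.single_eq_same, Nat.factorial_succ]
  push_cast
  ring

section HermiteMoments

variable {Ω : Type*} [MeasurableSpace Ω] {P : Measure Ω} {ι : Type*} [Fintype ι]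
  {X : ι → Ω → ℝ}

theorem HasGaussianLaw.integral_prod_Hpoly_add_single [DecidableEq ι]
    (hX : HasGaussianLaw (fun ω i => X i ω) P) (hmeas : ∀ i, Measurable (X i))
    (hcentered : ∀ i, ∫ ω, X i ω ∂P = 0) (j : ι) (hvar : ∫ ω, X j ω ^ 2 ∂P = 1)
    (q : ι → ℕ) :
    ∫ ω, ∏ i, Hpoly ((q + Pi.single j 1 : ι → ℕ) i) (X i ω) ∂P =
      ∑ k ∈ Finset.univ.erase j, (∫ ω, X j ω * X k ω ∂P) *
        (q k * ∫ ω, ∏ i, Hpoly ((q - Pi.single k 1 : ι → ℕ) i) (X i ω) ∂P) := by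
  have := hX.isProbabilityMeasure
  have hmom (i : ι) : HasAllMoments (X i) P := (hX.eval i).hasAllMoments
  have hH (n : ℕ) (i : ι) : HasAllMoments (fun ω => Hpoly n (X i ω)) P := by
    simpa only [Hpoly_eq_eval] using (hmom i).eval _
  have hsub (k : ι) (ω : Ω) : (∏ i ∈ Finset.univ.erase k, Hpoly (q i) (X i ω)) *
      (q k * Hpoly (q k - 1) (X k ω)) =
      q k * ∏ i, Hpoly ((q - Pi.single k 1 : ι → ℕ) i) (X i ω) := by
    rw [← Finset.prod_erase_mul (a := k) _ _ (Finset.mem_univ k)]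
    have : ∏ i ∈ Finset.univ.erase k, Hpoly ((q - Pi.single k 1 : ι → ℕ) i) (X i ω) =
        ∏ i ∈ Finset.univ.erase k, Hpoly (q i) (X i ω) :=
      Finset.prod_congr rfl fun i hi => by simp [Finset.ne_of_mem_erase hi]
    rw [this]
    simp
    ring
  have hadd (ω : Ω) : ∏ i, Hpoly ((q + Pi.single j 1 : ι → ℕ) i) (X i ω) =
      X j ω * ∏ i, Hpoly (q i) (X i ω) -
        q j * ∏ i, Hpoly ((q - Pi.single j 1 : ι → ℕ) i) (X i ω) := by
    rw [← hsub, ← Finset.prod_erase_mul (a := j) _ _ (Finset.mem_univ j),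
      ← Finset.prod_erase_mul (a := j) (f := fun i => Hpoly (q i) (X i ω)) _
        (Finset.mem_univ j)]
    have : ∏ i ∈ Finset.univ.erase j, Hpoly ((q + Pi.single j 1 : ι → ℕ) i) (X i ω) =
        ∏ i ∈ Finset.univ.erase j, Hpoly (q i) (X i ω) :=
      Finset.prod_congr rfl fun i hi => by simp [Finset.ne_of_mem_erase hi]
    rw [this, Pi.add_apply, Pi.single_eq_same, Hpoly_succ]
    ring
  have hibp := HasGaussianLaw.integral_mul_prod_eval hX hmeas hcentered j hvar
    fun i => (Polynomial.hermite (q i)).map (Int.castRingHom ℝ)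
  simp only [eval_derivative_hermite, ← Hpoly_eq_eval, hsub, integral_const_mul] at hibp
  simp_rw [hadd]
  rw [integral_sub ((hmom j).mul (.prod _ fun i => hH _ i)).integrable
    ((HasAllMoments.prod Finset.univ fun i => hH _ i).integrable.const_mul _), hibp,
    ← Finset.sum_erase_add _ _ (Finset.mem_univ j), integral_const_mul]
  simp_rw [← pow_two, hvar]
  ring

theorem HasGaussianLaw.integral_prod_Hpoly [LinearOrder ι]
    (hX : HasGaussianLaw (fun ω i => X i ω) P) (hmeas : ∀ i, Measurable (X i))
    (hcentered : ∀ i, ∫ ω, X i ω ∂P = 0) (hvar : ∀ i, ∫ ω, X i ω ^ 2 ∂P = 1) (q : ι → ℕ) :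
    ∫ ω, ∏ i, Hpoly (q i) (X i ω) ∂P =
      (∏ i, ((q i).factorial : ℝ)) *
        diagramSum endpoints_ne_zero (fun e => ∫ ω, X e.1.1 ω * X e.1.2 ω ∂P) q := by
  classical
  have := hX.isProbabilityMeasure
  induction hN : ∑ i, q i using Nat.strong_induction_on generalizing q with
  | _ N ih =>
    subst hN
    by_cases hq : q = 0
    · subst hq
      simp [diagramSum_zero, Hpoly]
    obtain ⟨j, hj⟩ := Function.ne_iff.1 hq
    obtain ⟨q, rfl⟩ : ∃ q', q = q' + Pi.single j 1 :=
      ⟨q - Pi.single j 1, (tsub_add_cancel_of_le fun i => by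
        rcases eq_or_ne i j with rfl | h
        · simpa using Nat.one_le_iff_ne_zero.2 hj
        · simp [h]).symm⟩
    set W := diagramSum endpoints_ne_zero (fun e => ∫ ω, X e.1.1 ω * X e.1.2 ω ∂P) with hW
    rw [HasGaussianLaw.integral_prod_Hpoly_add_single hX hmeas hcentered j (hvar j) q,
      prod_factorial_add_single, mul_assoc, hW, degree_mul_diagramSum, ← hW]
    have hsum := sum_endpoints_mul (fun a b : ι => (∫ ω, X a ω * X b ω ∂P) *
      if Pi.single a 1 + Pi.single b 1 ≤ q + Pi.single j 1 then
        W (q + Pi.single j 1 - (Pi.single a 1 + Pi.single b 1)) else 0)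
      (fun a b => by simp only [mul_comm (X a _), add_comm (Pi.single a 1 : ι → ℕ)]) j
    refine Eq.trans ?_ (congrArg _ hsum.symm)
    rw [Finset.mul_sum]
    refine Finset.sum_congr rfl fun k hk => ?_
    simp only [add_comm (Pi.single j 1 : ι → ℕ), add_le_add_iff_right,
      add_tsub_add_eq_tsub_right]
    rw [mul_left_comm (∏ i, ((q i).factorial : ℝ))]
    congr 1
    split_ifs with hle
    · obtain ⟨r, rfl⟩ : ∃ r, q = r + Pi.single k 1 :=
        ⟨q - Pi.single k 1, (tsub_add_cancel_of_le hle).symm⟩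
      rw [add_tsub_cancel_right, ih (∑ i, r i) (by simp [Finset.sum_add_distrib]) r rfl,
        prod_factorial_add_single, ← mul_assoc]
      congr 1
      ring
    · have hk0 : q k = 0 := by
        by_contra h
        refine hle fun i => ?_
        rcases eq_or_ne i k with rfl | hik
        · simpa using Nat.one_le_iff_ne_zero.2 h
        · simp [hik]
      simp [hk0]

end HermiteMoments

/-- Edge multiplicities on the complete graph as strictly upper triangular matrices. -/
def multiplicitiesEquivUpperTriangular (M : ℕ) (q : Fin M → ℕ) :
    {β // β ∈ multiplicities (endpoints_ne_zero (ι := Fin M)) q} ≃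
      {β : Fin M → Fin M → ℕ //
          (∀ j k : Fin M, ¬ j < k → β j k = 0) ∧
          ∀ i : Fin M, q i = ∑ j, ∑ k, if j < k ∧ (j = i ∨ k = i) then β j k else 0} :=
  have key (β : Fin M → Fin M → ℕ) (i : Fin M) :
      ∑ e : {e : Fin M × Fin M // e.1 < e.2}, β e.1.1 e.1.2 * endpoints e i =
        ∑ j, ∑ k, if j < k ∧ (j = i ∨ k = i) then β j k else 0 := by
    refine (sum_subtype_lt fun j k =>
      β j k * (Pi.single j 1 + Pi.single k 1 : Fin M → ℕ) i).trans ?_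
    refine Finset.sum_congr rfl fun j _ => Finset.sum_congr rfl fun k _ => ?_
    by_cases hjk : j < k
    · rcases eq_or_ne j i with rfl | hj
      · simp [hjk, hjk.ne]
      · rcases eq_or_ne k i with rfl | hk
        · simp [hjk, hj.symm]
        · simp [hjk, hj, hk, hj.symm, hk.symm]
    · simp [hjk]
  { toFun := fun β => ⟨fun j k => if h : j < k then β.1 ⟨(j, k), h⟩ else 0,
      fun j k h => by simp [h], fun i => by
        rw [← key, ← mem_multiplicities.1 β.2 i]
        exact Finset.sum_congr rfl fun e _ => by simp [e.2]⟩
    invFun := fun β => ⟨fun e => β.1 e.1.1 e.1.2, mem_multiplicities.2 fun i => by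
      rw [key, ← β.2.2 i]⟩
    left_inv := fun β => by
      ext e
      simp [e.2]
    right_inv := fun β => by
      ext j k
      by_cases h : j < k
      · simp [h]
      · simp [h, β.2.1 j k h] }

/-- Lemma 3.1: diagram formula for the expectation of a product of Hermite polynomials
of a centered jointly Gaussian vector with unit variances. -/
theorem hermite_product_formula
    {Ω : Type*} [MeasurableSpace Ω] (P : Measure Ω) [IsProbabilityMeasure P]
    (M : ℕ) (X : Fin M → Ω → ℝ) (ρ : Fin M → Fin M → ℝ) (q : Fin M → ℕ)
    (hq : ∀ i, 1 ≤ q i)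
    (hmeas : ∀ i, Measurable (X i))
    (hgauss : ∀ a : Fin M → ℝ, ∃ v : ℝ≥0,
      Measure.map (fun ω => ∑ i, a i * X i ω) P = gaussianReal 0 v)
    (hcentered : ∀ i, ∫ ω, X i ω ∂P = 0)
    (hvar : ∀ i, ∫ ω, X i ω ^ 2 ∂P = 1)
    (hcov : ∀ j k : Fin M, j < k → ∫ ω, X j ω * X k ω ∂P = ρ j k) :
    (∫ ω, ∏ i, Hpoly (q i) (X i ω) ∂P) =
      ∑' β : {β : Fin M → Fin M → ℕ //
          (∀ j k : Fin M, ¬ j < k → β j k = 0) ∧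
          ∀ i : Fin M, q i = ∑ j, ∑ k, if j < k ∧ (j = i ∨ k = i) then β j k else 0},
        ((∏ i, ((q i).factorial : ℝ)) /
            ∏ j, ∏ k, if j < k then ((β.1 j k).factorial : ℝ) else 1) *
          ∏ j, ∏ k, if j < k then ρ j k ^ β.1 j k else 1 := by
  have hX := hasGaussianLaw_of_map_sum_eq_gaussianReal hmeas hgauss
  rw [HasGaussianLaw.integral_prod_Hpoly hX hmeas hcentered hvar, diagramSum,
    ← Finset.tsum_subtype, ← tsum_mul_left,
    ← (multiplicitiesEquivUpperTriangular M q).symm.tsum_eq]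
  refine tsum_congr fun β => ?_
  rw [← prod_subtype_lt (fun j k => ((β.1 j k).factorial : ℝ)),
    ← prod_subtype_lt (fun j k => ρ j k ^ β.1 j k), div_mul_eq_mul_div, mul_div_assoc,
    ← Finset.prod_div_distrib]
  congr 1
  refine Finset.prod_congr rfl fun e _ => ?_
  rw [hcov _ _ e.2]
  rfl

end
end
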